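/- Let α ∈ ℂ be nonzero and let u, f, g, A, B be C^∞ complex-valued functions on an open subset of ℝ² (variables x, y) satisfying: α f_y = f_{xx} − 2u f_x, α g_y = −g_{xx} − 2u g_x; A_x = f g_x and α A_y = f_x g_x − f g_{xx} − 2u f g_x; B_x = f_x g and α B_y = f_{xx} g − f_x g_x − 2u f_x g; A + B = f g; and A, B vanish nowhere. Set u[1] = u + A_x/A − B_x/B. Then F = f/B satisfies α F_y = F_{xx} − 2u[1] F_x, and H = g/A satisfies α H_y = −H_{xx} − 2u[1] H_x. (The new source functions Ψ_{N+1}[1] = −(1/2)√(Ċ(t)) f/B and Φ_{N+1}[1] = (1/2)√(Ċ(t)) g/A of the generalized Darboux transformation satisfy the linear source equations (3.13.1)–(3.13.2) of the transformed system; the t-dependent factor √(Ċ(t)) is constant in x and y.) -/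

import Mathlib

noncomputable section

/-- Complex-valued functions of `(x, y) ∈ ℝ²`. -/
abbrev F2 := ℝ → ℝ → ℂ

/-- `C^∞` smoothness on a subset of `ℝ²`. -/
def Smooth2On (Ω : Set (ℝ × ℝ)) (f : F2) : Prop :=
  ContDiffOn ℝ (⊤ : ℕ∞) (fun p : ℝ × ℝ => f p.1 p.2) Ω

/-- partial derivative in `x`. -/
def px2 (f : F2) : F2 := fun x y => deriv (fun s => f s y) x

/-- partial derivative in `y`. -/
def py2 (f : F2) : F2 := fun x y => deriv (fun s => f x s) y

theorem Smooth2On.differentiableAt {Ω : Set (ℝ × ℝ)} (hΩ : IsOpen Ω) {f : F2}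
    (hf : Smooth2On Ω f) {x y : ℝ} (h : (x, y) ∈ Ω) :
    DifferentiableAt ℝ (fun p : ℝ × ℝ => f p.1 p.2) (x, y) :=
  (ContDiffOn.contDiffAt hf (hΩ.mem_nhds h)).differentiableAt (by simp)

theorem Smooth2On.hasDerivAt_px2 {Ω : Set (ℝ × ℝ)} (hΩ : IsOpen Ω) {f : F2}
    (hf : Smooth2On Ω f) {x y : ℝ} (h : (x, y) ∈ Ω) :
    HasDerivAt (fun s => f s y) (px2 f x y) x := by
  have hd : DifferentiableAt ℝ (fun s : ℝ => (s, y)) x := by fun_prop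
  exact (DifferentiableAt.comp (g := fun p : ℝ × ℝ => f p.1 p.2) (f := fun s => (s, y)) x
    (hf.differentiableAt hΩ h) hd).hasDerivAt

theorem Smooth2On.hasDerivAt_py2 {Ω : Set (ℝ × ℝ)} (hΩ : IsOpen Ω) {f : F2}
    (hf : Smooth2On Ω f) {x y : ℝ} (h : (x, y) ∈ Ω) :
    HasDerivAt (fun s => f x s) (py2 f x y) y := by
  have hd : DifferentiableAt ℝ (fun s : ℝ => (x, s)) y := by fun_prop
  exact (DifferentiableAt.comp (g := fun p : ℝ × ℝ => f p.1 p.2) (f := fun s => (x, s)) y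
    (hf.differentiableAt hΩ h) hd).hasDerivAt

theorem Smooth2On.hasDerivAt_px2_px2 {Ω : Set (ℝ × ℝ)} (hΩ : IsOpen Ω) {f : F2}
    (hf : Smooth2On Ω f) {x y : ℝ} (h : (x, y) ∈ Ω) :
    HasDerivAt (fun s => px2 f s y) (px2 (px2 f) x y) x := by
  have hs : IsOpen {s : ℝ | (s, y) ∈ Ω} := hΩ.preimage (by fun_prop)
  have hc : ContDiffOn ℝ 2 (fun s => f s y) {s : ℝ | (s, y) ∈ Ω} :=
    (ContDiffOn.comp (g := fun p : ℝ × ℝ => f p.1 p.2) hf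
      (f := fun s : ℝ => (s, y)) (by fun_prop) fun _ hs => hs).of_le
        (WithTop.coe_le_coe.2 (le_top : (2 : ℕ∞) ≤ ⊤))
  have hd : ContDiffOn ℝ 1 (deriv fun s => f s y) {s : ℝ | (s, y) ∈ Ω} :=
    hc.deriv_of_isOpen hs (by norm_num)
  exact ((hd.contDiffAt (hs.mem_nhds h)).differentiableAt (by simp)).hasDerivAt

/-- The equation for `f / B`. The one for `g / A` is the same statement after exchanging
`(f, B)` with `(g, A)` and changing the signs of `α` and `u`. -/
theorem darboux_quotient_linear_equation
    (α : ℂ) (Ω : Set (ℝ × ℝ)) (hΩ : IsOpen Ω) (u f g A B : F2)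
    (hf : Smooth2On Ω f) (hA : Smooth2On Ω A) (hB : Smooth2On Ω B)
    (hfe : ∀ x y, (x, y) ∈ Ω →
      α * py2 f x y = px2 (px2 f) x y - 2 * u x y * px2 f x y)
    (hAx : ∀ x y, (x, y) ∈ Ω → px2 A x y = f x y * px2 g x y)
    (hBx : ∀ x y, (x, y) ∈ Ω → px2 B x y = px2 f x y * g x y)
    (hBy : ∀ x y, (x, y) ∈ Ω →
      α * py2 B x y = px2 (px2 f) x y * g x y - px2 f x y * px2 g x y
        - 2 * u x y * px2 f x y * g x y)
    (hAB : ∀ x y, (x, y) ∈ Ω → A x y + B x y = f x y * g x y)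
    (hAne : ∀ x y, (x, y) ∈ Ω → A x y ≠ 0)
    (hBne : ∀ x y, (x, y) ∈ Ω → B x y ≠ 0) (x y : ℝ) (h : (x, y) ∈ Ω) :
    α * py2 (fun x y => f x y / B x y) x y =
      px2 (px2 fun x y => f x y / B x y) x y
        - 2 * (u x y + px2 A x y / A x y - px2 B x y / B x y)
          * px2 (fun x y => f x y / B x y) x y := by
  have hFx : ∀ s, (s, y) ∈ Ω → px2 (fun x y => f x y / B x y) s y =
      -(px2 f s y * A s y) / B s y ^ 2 := fun s hs => by
    have hd := ((hf.hasDerivAt_px2 hΩ hs).fun_div (hB.hasDerivAt_px2 hΩ hs) (hBne s y hs)).deriv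
    refine hd.trans ?_
    rw [hBx s y hs]
    congr 1
    linear_combination px2 f s y * hAB s y hs
  have hFy : py2 (fun x y => f x y / B x y) x y =
      (py2 f x y * B x y - f x y * py2 B x y) / B x y ^ 2 :=
    ((hf.hasDerivAt_py2 hΩ h).fun_div (hB.hasDerivAt_py2 hΩ h) (hBne x y h)).deriv
  have hs : IsOpen {s : ℝ | (s, y) ∈ Ω} := hΩ.preimage (by fun_prop)
  have hFxx := (((hf.hasDerivAt_px2_px2 hΩ h).fun_mul (hA.hasDerivAt_px2 hΩ h)).fun_neg.fun_div
    ((hB.hasDerivAt_px2 hΩ h).fun_pow 2) (pow_ne_zero 2 (hBne x y h))).congr_of_eventuallyEq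
      (Filter.eventuallyEq_of_mem (hs.mem_nhds h) hFx)
  have hB0 := hBne x y h
  have hA0 := hAne x y h
  have hFy' : α * py2 (fun x y => f x y / B x y) x y =
      (-(px2 (px2 f) x y - 2 * u x y * px2 f x y) * A x y
        + f x y * px2 f x y * px2 g x y) / B x y ^ 2 := by
    rw [hFy, ← mul_div_assoc]
    congr 1
    linear_combination B x y * hfe x y h - f x y * hBy x y h
      + (px2 (px2 f) x y - 2 * u x y * px2 f x y) * hAB x y h
  rw [hFy', show px2 (px2 fun x y => f x y / B x y) x y = _ from hFxx.deriv, hFx x h,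
    hAx x y h, hBx x y h]
  field_simp
  ring

/-- The new source functions `Ψ_{N+1}[1] ∝ f/B` and `Φ_{N+1}[1] ∝ g/A` of the
generalized Darboux transformation satisfy the linear source equations
(3.13.1)–(3.13.2) of the transformed system (the `t`-dependent factor `√(Ċ(t))`
being constant in `x` and `y`). -/
theorem darboux_new_source_functions_satisfy_linear_equations
    (α : ℂ) (hα : α ≠ 0) (Ω : Set (ℝ × ℝ)) (hΩ : IsOpen Ω)
    (u f g A B : F2)
    (hu : Smooth2On Ω u) (hf : Smooth2On Ω f) (hg : Smooth2On Ω g)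
    (hA : Smooth2On Ω A) (hB : Smooth2On Ω B)
    (hfe : ∀ x y, (x, y) ∈ Ω →
      α * py2 f x y = px2 (px2 f) x y - 2 * u x y * px2 f x y)
    (hge : ∀ x y, (x, y) ∈ Ω →
      α * py2 g x y = -(px2 (px2 g) x y) - 2 * u x y * px2 g x y)
    (hAx : ∀ x y, (x, y) ∈ Ω → px2 A x y = f x y * px2 g x y)
    (hAy : ∀ x y, (x, y) ∈ Ω →
      α * py2 A x y = px2 f x y * px2 g x y - f x y * px2 (px2 g) x y
        - 2 * u x y * f x y * px2 g x y)
    (hBx : ∀ x y, (x, y) ∈ Ω → px2 B x y = px2 f x y * g x y)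
    (hBy : ∀ x y, (x, y) ∈ Ω →
      α * py2 B x y = px2 (px2 f) x y * g x y - px2 f x y * px2 g x y
        - 2 * u x y * px2 f x y * g x y)
    (hAB : ∀ x y, (x, y) ∈ Ω → A x y + B x y = f x y * g x y)
    (hAne : ∀ x y, (x, y) ∈ Ω → A x y ≠ 0)
    (hBne : ∀ x y, (x, y) ∈ Ω → B x y ≠ 0)
    (u1 : F2) (hu1 : u1 = fun x y =>
      u x y + px2 A x y / A x y - px2 B x y / B x y)
    (F H : F2) (hF : F = fun x y => f x y / B x y)
    (hH : H = fun x y => g x y / A x y) :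
    (∀ x y, (x, y) ∈ Ω →
      α * py2 F x y = px2 (px2 F) x y - 2 * u1 x y * px2 F x y) ∧
    (∀ x y, (x, y) ∈ Ω →
      α * py2 H x y = -(px2 (px2 H) x y) - 2 * u1 x y * px2 H x y) := by
  subst hu1 hF hH
  refine ⟨darboux_quotient_linear_equation α Ω hΩ u f g A B hf hA hB hfe hAx hBx hBy hAB
    hAne hBne, fun x y h => ?_⟩
  have key := darboux_quotient_linear_equation (-α) Ω hΩ (fun x y => -u x y) g f B A hg hB hA
    (fun x y h => by linear_combination -hge x y h)
    (fun x y h => by linear_combination hBx x y h)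
    (fun x y h => by linear_combination hAx x y h)
    (fun x y h => by linear_combination -hAy x y h)
    (fun x y h => by linear_combination hAB x y h) hBne hAne x y h
  linear_combination -key

end
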